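/- Let z ~ N(0, I_q) and let f: ℝ^q → ℝ^q∖{0} be locally Lipschitz with E[ ‖f(z)‖^{-2} Σ_{k=1}^q ‖(∂/∂z_k)f(z)‖² ] < +∞. Then there exists Z ~ N(0,1) such that E[ ( (f(z)^⊤z − Σ_{k=1}^q (∂/∂z_k)f_k(z)) / ‖f(z)‖ − Z )² ] ≤ (7 + 2√6) · E[ ‖f(z)‖^{-2} Σ_{k=1}^q ‖(∂/∂z_k)f(z)‖² ]. -/

import Mathlib

open MeasureTheory ProbabilityTheory Matrix Filter Topology

noncomputable section

/-- Euclidean norm of a vector in `ℝ^k`. -/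
def vnorm {k : ℕ} (v : Fin k → ℝ) : ℝ := Real.sqrt (∑ i, v i ^ 2)

/-- The standard Gaussian measure on `Fin q → ℝ`. -/
abbrev gaussPi (q : ℕ) : Measure (Fin q → ℝ) := Measure.pi fun _ : Fin q => gaussianReal 0 1

lemma charFunDual_gaussPi {q : ℕ} (L : StrongDual ℝ (Fin q → ℝ)) :
    charFunDual (gaussPi q) L = Complex.exp (-(∑ i, (L (Pi.single i 1) : ℂ) ^ 2) / 2) := by
  rw [charFunDual_pi, neg_div, Finset.sum_div, ← Finset.sum_neg_distrib, Complex.exp_sum]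
  refine Finset.prod_congr rfl fun i _ => ?_
  rw [charFunDual_eq_charFun_map_one]
  have h : (⇑(L ∘SL ContinuousLinearMap.single ℝ (fun _ : Fin q => ℝ) i) : ℝ → ℝ)
      = fun x => L (Pi.single i 1) * x := by
    ext x
    have : (Pi.single i x : Fin q → ℝ) = x • Pi.single i 1 := by
      rw [← Pi.single_smul]; simp
    simp [this, mul_comm]
  rw [h, gaussianReal_map_const_mul, charFun_gaussianReal]
  congr 1
  simp

lemma map_gaussPi_dotProduct {q : ℕ} (u : Fin q → ℝ) :
    (gaussPi q).map (fun x => u ⬝ᵥ x) = gaussianReal 0 (∑ i, u i ^ 2).toNNReal := by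
  let L : StrongDual ℝ (Fin q → ℝ) := (dotProductBilin ℝ ℝ u).toContinuousLinearMap
  have hL : (fun x => u ⬝ᵥ x) = ⇑L := by ext x; simp [L]
  rw [hL]
  have : IsProbabilityMeasure ((gaussPi q).map L) :=
    Measure.isProbabilityMeasure_map L.continuous.measurable.aemeasurable
  refine Measure.ext_of_charFun ?_
  ext t
  have h1 : charFun ((gaussPi q).map L) t = charFunDual (gaussPi q) (t • L) := by
    rw [charFun_apply, charFunDual_apply, integral_map (by fun_prop) (by fun_prop)]
    simp [mul_comm]
  rw [h1, charFunDual_gaussPi, charFun_gaussianReal]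
  congr 1
  have h0 : 0 ≤ ∑ i, u i ^ 2 := by positivity
  simp [L, h0, mul_pow, Finset.mul_sum, mul_comm, neg_div]

lemma lintegral_dotProduct_sq_gaussPi {q : ℕ} (u : Fin q → ℝ) :
    ∫⁻ x, ENNReal.ofReal ((u ⬝ᵥ x) ^ 2) ∂(gaussPi q) = ENNReal.ofReal (∑ i, u i ^ 2) := by
  have hm : Measurable fun x : Fin q → ℝ => u ⬝ᵥ x := by unfold dotProduct; fun_prop
  rw [← lintegral_map (f := fun t : ℝ => ENNReal.ofReal (t ^ 2)) (by fun_prop) hm,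
    map_gaussPi_dotProduct]
  have h0 : 0 ≤ ∑ i, u i ^ 2 := by positivity
  have hi : Integrable (fun t : ℝ => t ^ 2) (gaussianReal 0 (∑ i, u i ^ 2).toNNReal) :=
    (memLp_id_gaussianReal 2).integrable_sq
  rw [← ofReal_integral_eq_lintegral_ofReal hi (ae_of_all _ fun _ => sq_nonneg _)]
  have hv := variance_id_gaussianReal (μ := 0) (v := (∑ i, u i ^ 2).toNNReal)
  rw [variance_of_integral_eq_zero aemeasurable_id (by simp)] at hv
  simp only [id] at hv
  rw [hv, Real.coe_toNNReal _ h0]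

/-- Rotation by the angle `θ` in the plane spanned by each pair of coordinates `(x i, y i)`. -/
def pairRotation {q : ℕ} (θ : ℝ) (p : (Fin q → ℝ) × (Fin q → ℝ)) : (Fin q → ℝ) × (Fin q → ℝ) :=
  (Real.cos θ • p.1 + Real.sin θ • p.2, -Real.sin θ • p.1 + Real.cos θ • p.2)

lemma map_pairRotation_gaussPi {q : ℕ} (θ : ℝ) :
    ((gaussPi q).prod (gaussPi q)).map (pairRotation θ) = (gaussPi q).prod (gaussPi q) := by
  let X := ContinuousLinearMap.fst ℝ (Fin q → ℝ) (Fin q → ℝ)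
  let Y := ContinuousLinearMap.snd ℝ (Fin q → ℝ) (Fin q → ℝ)
  let T := (Real.cos θ • X + Real.sin θ • Y).prod (-Real.sin θ • X + Real.cos θ • Y)
  have hT : pairRotation (q := q) θ = ⇑T := rfl
  rw [hT]
  have : IsProbabilityMeasure (((gaussPi q).prod (gaussPi q)).map T) :=
    Measure.isProbabilityMeasure_map T.continuous.measurable.aemeasurable
  refine Measure.ext_of_charFunDual ?_
  ext L
  rw [charFunDual_map, charFunDual_prod, charFunDual_prod]
  simp only [charFunDual_gaussPi, ← Complex.exp_add]
  congr 1
  rw [← add_div, ← add_div, ← neg_add, ← neg_add, ← Finset.sum_add_distrib,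
    ← Finset.sum_add_distrib]
  congr 2
  refine Finset.sum_congr rfl fun i _ => ?_
  have e1 : L (Real.cos θ • Pi.single i 1, -Real.sin θ • Pi.single i 1)
      = Real.cos θ * L (Pi.single i 1, 0) - Real.sin θ * L (0, Pi.single i 1) := by
    rw [← smul_eq_mul, ← smul_eq_mul, ← map_smul, ← map_smul, ← map_sub]; simp
  have e2 : L (Real.sin θ • Pi.single i 1, Real.cos θ • Pi.single i 1)
      = Real.sin θ * L (Pi.single i 1, 0) + Real.cos θ * L (0, Pi.single i 1) := by
    rw [← smul_eq_mul, ← smul_eq_mul, ← map_smul, ← map_smul, ← map_add]; simp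
  have e3 : (L ∘SL T) (Pi.single i 1, 0)
      = Real.cos θ * L (Pi.single i 1, 0) - Real.sin θ * L (0, Pi.single i 1) := by
    rw [← e1]; simp [T, X, Y]
  have e4 : (L ∘SL T) (0, Pi.single i 1)
      = Real.sin θ * L (Pi.single i 1, 0) + Real.cos θ * L (0, Pi.single i 1) := by
    rw [← e2]; simp [T, X, Y]
  change ((((L ∘SL T) (Pi.single i 1, 0) : ℝ) : ℂ)) ^ 2 + (((L ∘SL T) (0, Pi.single i 1) : ℝ) : ℂ) ^ 2
    = ((L (Pi.single i 1, 0) : ℝ) : ℂ) ^ 2 + ((L (0, Pi.single i 1) : ℝ) : ℂ) ^ 2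
  rw [e3, e4]
  norm_cast
  linear_combination
    (L (Pi.single i 1, 0) ^ 2 + L (0, Pi.single i 1) ^ 2) * Real.sin_sq_add_cos_sq θ

/-- The square root of the (unnormalized) standard Gaussian density. -/
def sqrtDensity {q : ℕ} (x : Fin q → ℝ) : ℝ := Real.exp (-(∑ i, x i ^ 2) / 4)

lemma gaussPi_eq_withDensity (q : ℕ) :
    ∃ c : ℝ, 0 < c ∧ gaussPi q =
      (volume : Measure (Fin q → ℝ)).withDensity fun x => ENNReal.ofReal (c * sqrtDensity x ^ 2) := by
  refine ⟨((Real.sqrt (2 * Real.pi))⁻¹) ^ q, by positivity, ?_⟩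
  have key : ∀ x : Fin q → ℝ, ((Real.sqrt (2 * Real.pi))⁻¹) ^ q * sqrtDensity x ^ 2
      = ∏ i, gaussianPDFReal 0 1 (x i) := by
    intro x
    simp only [gaussianPDFReal, Finset.prod_mul_distrib, sqrtDensity]
    rw [← Real.exp_sum, ← Real.exp_nat_mul]
    simp only [NNReal.coe_one, mul_one, Finset.prod_const, Finset.card_univ, Fintype.card_fin,
      sub_zero]
    congr 2
    rw [← Finset.sum_div, Finset.sum_neg_distrib]; push_cast; ring
  simp_rw [key]
  refine Measure.pi_eq fun s hs => ?_
  rw [withDensity_apply _ (MeasurableSet.univ_pi hs), volume_pi, Measure.restrict_pi_pi,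
    ← ofReal_integral_eq_lintegral_ofReal, integral_fintype_prod_eq_prod,
    ENNReal.ofReal_prod_of_nonneg]
  · refine Finset.prod_congr rfl fun i _ => ?_
    rw [gaussianReal_apply_eq_integral _ (by simp)]
  · exact fun i _ => integral_nonneg fun _ => gaussianPDFReal_nonneg _ _ _
  · exact Integrable.fintype_prod fun i => (integrable_gaussianPDFReal 0 1).integrableOn
  · exact ae_of_all _ fun x => Finset.prod_nonneg fun i _ => gaussianPDFReal_nonneg _ _ _

section LineDeriv

lemma lineDeriv_comp_add_right {E : Type*} [NormedAddCommGroup E] [NormedSpace ℝ E]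
    (A : E → ℝ) (w v x : E) :
    lineDeriv ℝ (fun y => A (y + w)) x v = lineDeriv ℝ A (x + w) v := by
  simp only [lineDeriv, add_right_comm]

variable {E : Type*} [NormedAddCommGroup E] [NormedSpace ℝ E] [MeasurableSpace E] [BorelSpace E]
  {μ : Measure E} {C D : NNReal} {A B : E → ℝ}

lemma LipschitzWith.integrable_lineDeriv_mul (hA : LipschitzWith C A) (v : E) {g : E → ℝ}
    (hg : Integrable g μ) : Integrable (fun x => lineDeriv ℝ A x v * g x) μ :=
  hg.bdd_mul (aestronglyMeasurable_lineDeriv hA.continuous μ)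
    (ae_of_all _ fun _ => norm_lineDeriv_le_of_lipschitz ℝ hA)

variable [FiniteDimensional ℝ E] [μ.IsAddHaarMeasure]

lemma LipschitzWith.integrable_lineDeriv (hA : LipschitzWith C A) (hA' : HasCompactSupport A)
    (v : E) : Integrable (fun x => lineDeriv ℝ A x v) μ := by
  have hc : HasCompactSupport fun x => lineDeriv ℝ A x v := by
    refine hA'.mono' fun x hx => ?_
    contrapose! hx
    have h0 : A =ᶠ[𝓝 x] fun _ => 0 := notMem_tsupport_iff_eventuallyEq.1 hx
    rw [Function.notMem_support, h0.lineDeriv_eq]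
    simp [lineDeriv]
  exact (integrableOn_iff_integrable_of_support_subset (subset_tsupport _)).1
    ((hA.locallyIntegrable_lineDeriv v).integrableOn_isCompact hc)

/-- The mixed second-order integration by parts formula for Lipschitz functions. -/
lemma LipschitzWith.integral_lineDeriv_mul_lineDeriv_comm (hA : LipschitzWith C A)
    (hB : LipschitzWith D B) (hA' : HasCompactSupport A) (hB' : HasCompactSupport B) (v w : E) :
    ∫ x, lineDeriv ℝ A x v * lineDeriv ℝ B x w ∂μ
      = ∫ x, lineDeriv ℝ A x w * lineDeriv ℝ B x v ∂μ := by
  have iA : ∀ v, Integrable (fun x => lineDeriv ℝ A x v) μ := hA.integrable_lineDeriv hA'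
  have iB : ∀ v, Integrable (fun x => lineDeriv ℝ B x v) μ := hB.integrable_lineDeriv hB'
  have l1 := hA.integral_inv_smul_sub_mul_tendsto_integral_lineDeriv_mul (iB w) v
  have l2 := hB.integral_inv_smul_sub_mul_tendsto_integral_lineDeriv_mul (iA w) (-v)
  have key : ∀ t : ℝ, ∫ x, (t⁻¹ • (A (x + t • v) - A x)) * lineDeriv ℝ B x w ∂μ
      = -∫ x, (t⁻¹ • (B (x + t • (-v)) - B x)) * lineDeriv ℝ A x w ∂μ := by
    intro t
    have hAt : LipschitzWith C fun x => A (x + t • v) := by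
      have := hA.comp (isometry_add_right (t • v)).lipschitz
      rwa [mul_one] at this
    have hAt' : HasCompactSupport fun x => A (x + t • v) :=
      hA'.comp_homeomorph (Homeomorph.addRight (t • v))
    have e1 : ∫ x, A (x + t • v) * lineDeriv ℝ B x w ∂μ
        = -∫ x, lineDeriv ℝ A x w * B (x + t • (-v)) ∂μ := by
      have := hB.integral_lineDeriv_mul_eq (μ := μ) hAt hAt' w
      simp_rw [mul_comm (A _), this]
      rw [← integral_neg, ← integral_add_right_eq_self _ (t • (-v))]
      congr 1; ext x
      rw [lineDeriv_neg, lineDeriv_comp_add_right]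
      simp
    have e2 : ∫ x, A x * lineDeriv ℝ B x w ∂μ = -∫ x, lineDeriv ℝ A x w * B x ∂μ := by
      have := hB.integral_lineDeriv_mul_eq (μ := μ) hA hA' w
      simp_rw [mul_comm (A _), this]
      rw [← integral_neg]
      simp [lineDeriv_neg]
    have cA := hA.continuous
    have cB := hB.continuous
    have bA := hAt.continuous.integrable_of_hasCompactSupport (μ := μ) hAt'
    have bB : Integrable (fun x => B (x + t • (-v))) μ :=
      Continuous.integrable_of_hasCompactSupport (by fun_prop)
        (hB'.comp_homeomorph (Homeomorph.addRight (t • (-v))))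
    have hm : ∫ x, (A (x + t • v) - A x) * lineDeriv ℝ B x w ∂μ
        = -∫ x, (B (x + t • (-v)) - B x) * lineDeriv ℝ A x w ∂μ := by
      simp_rw [sub_mul]
      rw [integral_sub, integral_sub, e1, e2]
      · simp_rw [mul_comm (B _)]; ring
      · simpa only [mul_comm] using hA.integrable_lineDeriv_mul w bB
      · simpa only [mul_comm] using hA.integrable_lineDeriv_mul w
          (cB.integrable_of_hasCompactSupport hB')
      · simpa only [mul_comm] using hB.integrable_lineDeriv_mul w bA
      · simpa only [mul_comm] using hB.integrable_lineDeriv_mul w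
          (cA.integrable_of_hasCompactSupport hA')
    simp only [smul_eq_mul, mul_assoc, integral_const_mul, hm]
    ring
  simp_rw [key] at l1
  have := tendsto_nhds_unique l1 l2.neg
  rw [this, ← integral_neg]
  congr 1; ext x
  rw [lineDeriv_neg]; ring

end LineDeriv

lemma LocallyLipschitz.exists_lipschitzWith_of_hasCompactSupport {E F : Type*}
    [NormedAddCommGroup E] [ProperSpace E] [NormedAddCommGroup F] {f : E → F}
    (hf : LocallyLipschitz f) (hc : HasCompactSupport f) : ∃ C, LipschitzWith C f := by
  have hK : IsCompact (Metric.cthickening 1 (tsupport f)) := IsCompact.cthickening hc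
  obtain ⟨C, hC⟩ := hf.locallyLipschitzOn.exists_lipschitzOnWith_of_compact hK
  obtain ⟨M, hM⟩ := hf.continuous.bounded_above_of_compact_support hc
  have hM0 : 0 ≤ M := (norm_nonneg _).trans (hM 0)
  have main : ∀ x ∈ tsupport f, ∀ y, dist (f x) (f y) ≤ (C + M.toNNReal : NNReal) * dist x y := by
    intro x hx y
    have hd := dist_nonneg (x := x) (y := y)
    rw [NNReal.coe_add, Real.coe_toNNReal _ hM0, add_mul]
    by_cases hy : y ∈ Metric.cthickening 1 (tsupport f)
    · have := hC.dist_le_mul x (Metric.self_subset_cthickening _ hx) y hy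
      have := mul_nonneg hM0 hd
      linarith
    · have h1 : 1 < dist x y := by
        by_contra! h
        exact hy (Metric.mem_cthickening_of_dist_le y x 1 _ hx (by rwa [dist_comm]))
      have h2 : f y = 0 := by
        by_contra h
        exact hy (Metric.self_subset_cthickening _ (subset_tsupport f h))
      rw [h2, dist_zero_right]
      have := mul_nonneg C.coe_nonneg hd
      nlinarith [hM x]
  refine ⟨C + M.toNNReal, LipschitzWith.of_dist_le_mul fun x y => ?_⟩
  by_cases hx : x ∈ tsupport f
  · exact main x hx y
  by_cases hy : y ∈ tsupport f
  · rw [dist_comm, dist_comm x]; exact main y hy x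
  · rw [image_eq_zero_of_notMem_tsupport hx, image_eq_zero_of_notMem_tsupport hy, dist_self]
    positivity

/-- The partial derivative along the `k`-th coordinate. -/
abbrev partialDeriv {q : ℕ} (k : Fin q) (a : (Fin q → ℝ) → ℝ) (x : Fin q → ℝ) : ℝ :=
  lineDeriv ℝ a x (Pi.single k 1)

lemma hasLineDerivAt_sqrtDensity {q : ℕ} (k : Fin q) (x : Fin q → ℝ) :
    HasLineDerivAt ℝ sqrtDensity (-(x k / 2) * sqrtDensity x) x (Pi.single k 1) := by
  have h1 : ∀ i, HasDerivAt (fun t : ℝ => (x i + t * (Pi.single k 1 : Fin q → ℝ) i) ^ 2)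
      (2 * x i * (Pi.single k 1 : Fin q → ℝ) i) 0 := by
    intro i
    simpa using (((hasDerivAt_id' (0 : ℝ)).mul_const ((Pi.single k 1 : Fin q → ℝ) i)).const_add
      (x i)).fun_pow 2
  have h2 := ((HasDerivAt.fun_sum fun i (_ : i ∈ Finset.univ) => h1 i).fun_neg.div_const 4).exp
  change HasDerivAt (fun t : ℝ => sqrtDensity (x + t • Pi.single k 1)) _ 0
  refine HasDerivAt.congr_deriv h2 ?_
  simp [sqrtDensity, Pi.single_apply]
  ring

lemma contDiff_sqrtDensity {q : ℕ} : ContDiff ℝ 1 (sqrtDensity (q := q)) := by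
  unfold sqrtDensity; fun_prop

lemma LipschitzWith.ae_hasLineDerivAt {q : ℕ} {C : NNReal} {a : (Fin q → ℝ) → ℝ}
    (ha : LipschitzWith C a) (v : Fin q → ℝ) :
    ∀ᵐ x ∂(volume : Measure (Fin q → ℝ)), HasLineDerivAt ℝ a (lineDeriv ℝ a x v) x v := by
  filter_upwards [ha.ae_lineDifferentiableAt v] with x hx using hx.hasLineDerivAt

lemma HasLineDerivAt.mul_real {q : ℕ} {a b : (Fin q → ℝ) → ℝ} {a' b' : ℝ} {x v : Fin q → ℝ}
    (ha : HasLineDerivAt ℝ a a' x v) (hb : HasLineDerivAt ℝ b b' x v) :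
    HasLineDerivAt ℝ (fun y => a y * b y) (a' * b x + a x * b') x v := by
  have h := HasDerivAt.fun_mul (ha : HasDerivAt _ _ _) (hb : HasDerivAt _ _ _)
  simp only [zero_smul, add_zero] at h
  exact h

lemma LocallyLipschitz.mul_real {X : Type*} [PseudoEMetricSpace X] {a b : X → ℝ}
    (ha : LocallyLipschitz a) (hb : LocallyLipschitz b) : LocallyLipschitz fun x => a x * b x :=
  (show ContDiff ℝ 1 fun p : ℝ × ℝ => p.1 * p.2 by fun_prop).locallyLipschitz.comp
    (ha.prodMk hb)

lemma integral_coord_mul_partialDeriv {q : ℕ} {C D : NNReal} {A B : (Fin q → ℝ) → ℝ}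
    (hA : LipschitzWith C A) (hB : LipschitzWith D B) (hA' : HasCompactSupport A)
    (hB' : HasCompactSupport B) (j k : Fin q) :
    (∫ x, partialDeriv k A x * (x j * B x)) + ∫ x, partialDeriv k B x * (x j * A x)
      = -((if j = k then 1 else 0) * ∫ x, A x * B x) := by
  have cA := hA.continuous
  have cB := hB.continuous
  have iA : Integrable fun x : Fin q → ℝ => x j * A x :=
    Continuous.integrable_of_hasCompactSupport (by fun_prop) hA'.mul_left
  have iB : Integrable fun x : Fin q → ℝ => x j * B x :=
    Continuous.integrable_of_hasCompactSupport (by fun_prop) hB'.mul_left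
  have hAB' : HasCompactSupport fun x => A x * B x := hA'.mul_right
  have hl : LocallyLipschitz fun x => A x * B x := 
    hA.locallyLipschitz.mul_real hB.locallyLipschitz
  obtain ⟨K, hK⟩ := hl.exists_lipschitzWith_of_hasCompactSupport hAB'
  have hproj : LipschitzWith 1 fun x : Fin q → ℝ => x j := LipschitzWith.eval j
  have h := hproj.integral_lineDeriv_mul_eq (μ := volume) hK hAB' (Pi.single k 1)
  have hj : ∀ x : Fin q → ℝ, lineDeriv ℝ (fun x : Fin q → ℝ => x j) x (Pi.single k 1)
      = if j = k then 1 else 0 := by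
    intro x
    have : HasLineDerivAt ℝ (fun x : Fin q → ℝ => x j) (if j = k then 1 else 0) x
        (Pi.single k 1) := by
      change HasDerivAt (fun t : ℝ => x j + t * (Pi.single k 1 : Fin q → ℝ) j) _ 0
      simpa [Pi.single_apply] using
        ((hasDerivAt_id' (0 : ℝ)).mul_const ((Pi.single k 1 : Fin q → ℝ) j)).const_add (x j)
    exact this.lineDeriv
  simp_rw [hj, integral_const_mul] at h
  rw [h, ← integral_add (hA.integrable_lineDeriv_mul _ iB) (hB.integrable_lineDeriv_mul _ iA),
    ← integral_neg]
  refine integral_congr_ae ?_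
  filter_upwards [hA.ae_hasLineDerivAt (Pi.single k 1), hB.ae_hasLineDerivAt (Pi.single k 1)]
    with x hx hy
  rw [lineDeriv_neg, (hx.mul_real hy).lineDeriv]
  ring

/-- Second-order Stein identity with respect to the Lebesgue measure, for functions multiplied by
the square root of the Gaussian density. -/
lemma integral_creation_mul_creation {q : ℕ} {C D : NNReal} {A B : (Fin q → ℝ) → ℝ}
    (hA : LipschitzWith C A) (hB : LipschitzWith D B) (hA' : HasCompactSupport A)
    (hB' : HasCompactSupport B) (j k : Fin q) :
    ∫ x, (x j / 2 * A x - partialDeriv j A x) * (x k / 2 * B x - partialDeriv k B x)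
      = (if j = k then 1 else 0) * (∫ x, A x * B x)
        + ∫ x, (x k / 2 * A x + partialDeriv k A x) * (x j / 2 * B x + partialDeriv j B x) := by
  have cA := hA.continuous
  have cB := hB.continuous
  have iA : ∀ j, Integrable fun x : Fin q → ℝ => x j * A x := fun j =>
    Continuous.integrable_of_hasCompactSupport (by fun_prop) hA'.mul_left
  have iB : ∀ j, Integrable fun x : Fin q → ℝ => x j * B x := fun j =>
    Continuous.integrable_of_hasCompactSupport (by fun_prop) hB'.mul_left
  have iAB : Integrable fun x : Fin q → ℝ => x j * x k * (A x * B x) :=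
    Continuous.integrable_of_hasCompactSupport (by fun_prop) hA'.mul_right.mul_left
  have iAdB := fun j k => hB.integrable_lineDeriv_mul (Pi.single k 1) (iA j)
  have iBdA := fun j k => hA.integrable_lineDeriv_mul (Pi.single k 1) (iB j)
  have idd := fun j k : Fin q => hA.integrable_lineDeriv_mul (Pi.single j 1)
    (hB.integrable_lineDeriv (μ := volume) hB' (Pi.single k 1))
  have hs := hA.integral_lineDeriv_mul_lineDeriv_comm (μ := volume) hB hA' hB' (Pi.single j 1)
    (Pi.single k 1)
  have hjk := integral_coord_mul_partialDeriv hA hB hA' hB' j k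
  have hkj := integral_coord_mul_partialDeriv hA hB hA' hB' k j
  have expand : ∀ (s : ℝ) {a b c d : (Fin q → ℝ) → ℝ}, Integrable a → Integrable b →
      Integrable c → Integrable d → ∫ x, (1 / 4 * a x + s * b x + s * c x + d x)
        = 1 / 4 * (∫ x, a x) + s * (∫ x, b x) + s * (∫ x, c x) + ∫ x, d x := by
    intro s a b c d ha hb hc hd
    have h1 : Integrable fun x => 1 / 4 * a x + s * b x := (ha.const_mul _).add (hb.const_mul _)
    have h2 : Integrable fun x => 1 / 4 * a x + s * b x + s * c x := h1.add (hc.const_mul _)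
    rw [integral_add h2 hd, integral_add h1 (hc.const_mul _), integral_add (ha.const_mul _)
      (hb.const_mul _)]
    simp only [integral_const_mul]
  have e1 := expand (-1 / 2) iAB (iAdB j k) (iBdA k j) (idd j k)
  have e2 := expand (1 / 2) iAB (iAdB k j) (iBdA j k) (idd k j)
  have r1 : ∀ x, (x j / 2 * A x - partialDeriv j A x) * (x k / 2 * B x - partialDeriv k B x)
      = 1 / 4 * (x j * x k * (A x * B x)) + -1 / 2 * (partialDeriv k B x * (x j * A x))
        + -1 / 2 * (partialDeriv j A x * (x k * B x))
        + partialDeriv j A x * partialDeriv k B x := fun x => by ring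
  have r2 : ∀ x, (x k / 2 * A x + partialDeriv k A x) * (x j / 2 * B x + partialDeriv j B x)
      = 1 / 4 * (x j * x k * (A x * B x)) + 1 / 2 * (partialDeriv j B x * (x k * A x))
        + 1 / 2 * (partialDeriv k A x * (x j * B x))
        + partialDeriv k A x * partialDeriv j B x := fun x => by ring
  simp_rw [r1, r2]
  rw [e1, e2, hs]
  simp only [eq_comm (a := k)] at hkj
  linarith

lemma partialDeriv_mul_sqrtDensity {q : ℕ} {C : NNReal} {a : (Fin q → ℝ) → ℝ}
    (ha : LipschitzWith C a) (j : Fin q) :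
    ∀ᵐ x ∂(volume : Measure (Fin q → ℝ)), partialDeriv j (fun x => a x * sqrtDensity x) x
      = (partialDeriv j a x - x j / 2 * a x) * sqrtDensity x := by
  filter_upwards [ha.ae_hasLineDerivAt (Pi.single j (1 : ℝ))] with x hx
  rw [partialDeriv, (hx.mul_real (hasLineDerivAt_sqrtDensity j x)).lineDeriv]
  ring

lemma integral_gaussPi {q : ℕ} : ∃ c : ℝ, ∀ F : (Fin q → ℝ) → ℝ,
    ∫ x, F x ∂gaussPi q = c * ∫ x, sqrtDensity x ^ 2 * F x := by
  obtain ⟨c, hc, h⟩ := gaussPi_eq_withDensity q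
  refine ⟨c, fun F => ?_⟩
  have hm : Measurable fun x : Fin q → ℝ => ENNReal.ofReal (c * sqrtDensity x ^ 2) := by
    have := (contDiff_sqrtDensity (q := q)).continuous
    fun_prop
  rw [h, integral_withDensity_eq_integral_toReal_smul hm (ae_of_all _ fun _ => ENNReal.ofReal_lt_top),
    ← integral_const_mul]
  congr 1; ext x
  rw [ENNReal.toReal_ofReal (by positivity), smul_eq_mul, mul_assoc]

/-- The commutation relation of the Gaussian creation and annihilation operators. -/
lemma integral_creation_mul_creation_gaussPi {q : ℕ} {C D : NNReal} {a b : (Fin q → ℝ) → ℝ}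
    (ha : LipschitzWith C a) (hb : LipschitzWith D b) (ha' : HasCompactSupport a)
    (hb' : HasCompactSupport b) (j k : Fin q) :
    ∫ x, (x j * a x - partialDeriv j a x) * (x k * b x - partialDeriv k b x) ∂gaussPi q
      = (if j = k then 1 else 0) * (∫ x, a x * b x ∂gaussPi q)
        + ∫ x, partialDeriv k a x * partialDeriv j b x ∂gaussPi q := by
  obtain ⟨c, hc⟩ := integral_gaussPi (q := q)
  have hs := (contDiff_sqrtDensity (q := q)).locallyLipschitz
  have hA' : HasCompactSupport fun x => a x * sqrtDensity x := ha'.mul_right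
  have hB' : HasCompactSupport fun x => b x * sqrtDensity x := hb'.mul_right
  obtain ⟨_, hA⟩ :=
    (ha.locallyLipschitz.mul_real hs).exists_lipschitzWith_of_hasCompactSupport hA'
  obtain ⟨_, hB⟩ :=
    (hb.locallyLipschitz.mul_real hs).exists_lipschitzWith_of_hasCompactSupport hB'
  have h := integral_creation_mul_creation hA hB hA' hB' j k
  simp only [hc]
  rw [mul_left_comm, ← mul_add]
  congr 1
  have e1 : ∫ x, sqrtDensity x ^ 2 * ((x j * a x - partialDeriv j a x)
      * (x k * b x - partialDeriv k b x)) = ∫ x,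
      (x j / 2 * (a x * sqrtDensity x) - partialDeriv j (fun x => a x * sqrtDensity x) x)
      * (x k / 2 * (b x * sqrtDensity x) - partialDeriv k (fun x => b x * sqrtDensity x) x) := by
    refine integral_congr_ae ?_
    filter_upwards [partialDeriv_mul_sqrtDensity ha j, partialDeriv_mul_sqrtDensity hb k]
      with x h1 h2
    rw [h1, h2]; ring
  have e2 : ∫ x, sqrtDensity x ^ 2 * (partialDeriv k a x * partialDeriv j b x)
      = ∫ x, (x k / 2 * (a x * sqrtDensity x) + partialDeriv k (fun x => a x * sqrtDensity x) x)
      * (x j / 2 * (b x * sqrtDensity x) + partialDeriv j (fun x => b x * sqrtDensity x) x) := by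
    refine integral_congr_ae ?_
    filter_upwards [partialDeriv_mul_sqrtDensity ha k, partialDeriv_mul_sqrtDensity hb j]
      with x h1 h2
    rw [h1, h2]; ring
  have e3 : ∫ x, sqrtDensity x ^ 2 * (a x * b x)
      = ∫ x, (a x * sqrtDensity x) * (b x * sqrtDensity x) := by
    congr 1; ext x; ring
  rw [e1, e2, e3, h]

/-- The Gaussian divergence (Skorokhod integral) of a vector field. -/
def gaussDiv {q : ℕ} (g : (Fin q → ℝ) → Fin q → ℝ) (x : Fin q → ℝ) : ℝ :=
  ∑ j, (x j * g x j - partialDeriv j (fun y => g y j) x)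

/-- The squared Hilbert-Schmidt norm of the gradient of a vector field. -/
def gradSq {q : ℕ} (g : (Fin q → ℝ) → Fin q → ℝ) (x : Fin q → ℝ) : ℝ :=
  ∑ j, ∑ k, partialDeriv k (fun y => g y j) x ^ 2

lemma gradSq_nonneg {q : ℕ} (g : (Fin q → ℝ) → Fin q → ℝ) (x : Fin q → ℝ) : 0 ≤ gradSq g x := by
  unfold gradSq; positivity

lemma lintegral_gaussDiv_sq_le_of_hasCompactSupport {q : ℕ} {g : (Fin q → ℝ) → Fin q → ℝ}
    (hg : ∀ j, ∃ C, LipschitzWith C fun x => g x j)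
    (hg' : ∀ j, HasCompactSupport fun x => g x j) :
    ∫⁻ x, ENNReal.ofReal (gaussDiv g x ^ 2) ∂gaussPi q
      ≤ ∫⁻ x, ENNReal.ofReal (∑ j, g x j ^ 2 + gradSq g x) ∂gaussPi q := by
  choose C hC using hg
  have hcont : ∀ j, Continuous fun x => g x j := fun j => (hC j).continuous
  have mp : ∀ j k, MemLp (fun x => partialDeriv k (fun y => g y j) x) 2 (gaussPi q) := fun j k =>
    MemLp.of_bound (aestronglyMeasurable_lineDeriv (hcont j) _) _
      (ae_of_all _ fun _ => norm_lineDeriv_le_of_lipschitz ℝ (hC j))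
  have mc : ∀ a : (Fin q → ℝ) → ℝ, Continuous a → HasCompactSupport a →
      MemLp a 2 (gaussPi q) := by
    intro a ha ha'
    obtain ⟨M, hM⟩ := ha.bounded_above_of_compact_support ha'
    exact MemLp.of_bound ha.aestronglyMeasurable M (ae_of_all _ hM)
  have mg := fun j => mc _ (hcont j) (hg' j)
  have md : ∀ j, MemLp (fun x => x j * g x j - partialDeriv j (fun y => g y j) x) 2
      (gaussPi q) := by
    intro j
    have hc := hcont j
    exact (mc _ (by fun_prop) (hg' j).mul_left).sub (mp j j)
  have key : ∫ x, gaussDiv g x ^ 2 ∂gaussPi q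
      = ∫ x, (∑ j, g x j ^ 2 + ∑ j, ∑ k,
        partialDeriv k (fun y => g y j) x * partialDeriv j (fun y => g y k) x) ∂gaussPi q := by
    simp_rw [gaussDiv, sq, Finset.sum_mul_sum]
    rw [integral_add, integral_finsetSum, integral_finsetSum, integral_finsetSum,
      ← Finset.sum_add_distrib]
    · refine Finset.sum_congr rfl fun j _ => ?_
      rw [integral_finsetSum, integral_finsetSum]
      · simp_rw [fun k => integral_creation_mul_creation_gaussPi (hC j) (hC k) (hg' j) (hg' k) j k]
        simp [Finset.sum_add_distrib]
      · exact fun k _ => (mp j k).integrable_mul (mp k j)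
      · exact fun k _ => (md j).integrable_mul (md k)
    · exact fun j _ => integrable_finsetSum _ fun k _ => (mp j k).integrable_mul (mp k j)
    · exact fun j _ => (mg j).integrable_mul (mg j)
    · exact fun j _ => integrable_finsetSum _ fun k _ => (md j).integrable_mul (md k)
    · exact integrable_finsetSum _ fun j _ => (mg j).integrable_mul (mg j)
    · exact integrable_finsetSum _ fun j _ => integrable_finsetSum _ fun k _ =>
        (mp j k).integrable_mul (mp k j)
  have iG : Integrable (fun x => ∑ j, g x j ^ 2) (gaussPi q) :=
    integrable_finsetSum _ fun j _ => (mg j).integrable_sq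
  have iS : Integrable (gradSq g) (gaussPi q) :=
    integrable_finsetSum _ fun j _ => integrable_finsetSum _ fun k _ => (mp j k).integrable_sq
  have iGS : Integrable (fun x => ∑ j, g x j ^ 2 + gradSq g x) (gaussPi q) := iG.add iS
  have iD : Integrable (fun x => gaussDiv g x ^ 2) (gaussPi q) :=
    (memLp_finsetSum _ fun j _ => md j).integrable_sq
  rw [← ofReal_integral_eq_lintegral_ofReal iD (ae_of_all _ fun _ => sq_nonneg _),
    ← ofReal_integral_eq_lintegral_ofReal iGS (ae_of_all _ fun x => add_nonneg
      (Finset.sum_nonneg fun _ _ => sq_nonneg _) (gradSq_nonneg g x)), key]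
  refine ENNReal.ofReal_le_ofReal (integral_mono (iG.add (integrable_finsetSum _ fun j _ =>
    integrable_finsetSum _ fun k _ => (mp j k).integrable_mul (mp k j))) iGS fun x => ?_)
  have hs : ∑ j, ∑ k, partialDeriv j (fun y => g y k) x ^ 2 = gradSq g x := Finset.sum_comm
  have : ∑ j, ∑ k, partialDeriv k (fun y => g y j) x * partialDeriv j (fun y => g y k) x
      ≤ ∑ j, ∑ k, (partialDeriv k (fun y => g y j) x ^ 2
        + partialDeriv j (fun y => g y k) x ^ 2) / 2 := by
    gcongr with j _ k _
    nlinarith [sq_nonneg (partialDeriv k (fun y => g y j) x - partialDeriv j (fun y => g y k) x)]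
  simp_rw [← Finset.sum_div, Finset.sum_add_distrib, hs] at this
  rw [show ∑ j, ∑ k, partialDeriv k (fun y => g y j) x ^ 2 = gradSq g x from rfl] at this
  change ∑ j, g x j ^ 2 + _ ≤ ∑ j, g x j ^ 2 + gradSq g x
  linarith

lemma gaussPi_absolutelyContinuous (q : ℕ) :
    gaussPi q ≪ (volume : Measure (Fin q → ℝ)) := by
  obtain ⟨c, -, h⟩ := gaussPi_eq_withDensity q
  exact h ▸ withDensity_absolutelyContinuous _ _

lemma measurable_gaussDiv {q : ℕ} {g : (Fin q → ℝ) → Fin q → ℝ}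
    (hg : ∀ j, LocallyLipschitz fun x => g x j) : Measurable (gaussDiv g) := by
  refine Finset.measurable_sum _ fun j _ => Measurable.sub ?_
    (measurable_lineDeriv (hg j).continuous)
  exact (measurable_pi_apply j).mul (hg j).continuous.measurable

/-- A cutoff function equal to `1` on the ball of radius `n + 1`. -/
def ballCutoff {q : ℕ} (n : ℕ) (x : Fin q → ℝ) : ℝ := max 0 (min 1 (2 - ‖x‖ / (n + 1)))

lemma lipschitzWith_ballCutoff {q : ℕ} (n : ℕ) :
    LipschitzWith (1 / ((n : NNReal) + 1)) (ballCutoff (q := q) n) := by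
  refine LipschitzWith.const_max (LipschitzWith.const_min ?_ 1) 0
  refine LipschitzWith.of_dist_le_mul fun x y => ?_
  rw [Real.dist_eq, show 2 - ‖x‖ / ((n : ℝ) + 1) - (2 - ‖y‖ / (n + 1))
    = (‖y‖ - ‖x‖) / (n + 1) by ring, abs_div, abs_of_pos (by positivity : (0 : ℝ) < n + 1),
    abs_sub_comm, dist_eq_norm]
  push_cast
  rw [div_mul_eq_mul_div, one_mul]
  gcongr
  exact abs_norm_sub_norm_le x y

lemma hasCompactSupport_ballCutoff {q : ℕ} (n : ℕ) :
    HasCompactSupport (ballCutoff (q := q) n) := by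
  refine HasCompactSupport.of_support_subset_isCompact
    (isCompact_closedBall 0 (2 * ((n : ℝ) + 1))) fun x hx => ?_
  contrapose! hx
  rw [mem_closedBall_zero_iff, not_le] at hx
  have : 2 ≤ ‖x‖ / ((n : ℝ) + 1) := (le_div_iff₀ (by positivity)).2 hx.le
  rw [Function.notMem_support, ballCutoff, max_eq_left]
  exact (min_le_right _ _).trans (by linarith)

lemma ballCutoff_eventuallyEq_one {q : ℕ} {n : ℕ} {x : Fin q → ℝ} (hx : ‖x‖ < n + 1) :
    ballCutoff n =ᶠ[𝓝 x] fun _ => 1 := by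
  filter_upwards [(continuous_norm.tendsto x).eventually_lt_const hx] with y hy
  have : ‖y‖ / ((n : ℝ) + 1) ≤ 1 := (div_le_one (by positivity)).2 hy.le
  rw [ballCutoff, min_eq_left (by linarith)]
  simp

lemma abs_ballCutoff_le_one {q : ℕ} (n : ℕ) (x : Fin q → ℝ) : |ballCutoff n x| ≤ 1 := by
  rw [ballCutoff, abs_of_nonneg (le_max_left _ _)]
  simp

lemma gradSq_ballCutoff_mul_le {q : ℕ} {g : (Fin q → ℝ) → Fin q → ℝ}
    (hd : ∀ j, ∀ᵐ x ∂(volume : Measure (Fin q → ℝ)), DifferentiableAt ℝ (fun y => g y j) x)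
    (n : ℕ) : ∀ᵐ x ∂(volume : Measure (Fin q → ℝ)), gradSq (fun x j => ballCutoff n x * g x j) x
      ≤ 2 * gradSq g x + 2 * q / ((n : ℝ) + 1) ^ 2 * ∑ j, g x j ^ 2 := by
  have h1 : ∀ᵐ x ∂(volume : Measure (Fin q → ℝ)), ∀ k, HasLineDerivAt ℝ (ballCutoff n)
      (partialDeriv k (ballCutoff n) x) x (Pi.single k (1 : ℝ)) :=
    ae_all_iff.2 fun k => (lipschitzWith_ballCutoff n).ae_hasLineDerivAt _
  filter_upwards [ae_all_iff.2 hd, h1] with x hx h1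
  have hc : ∀ k, partialDeriv k (ballCutoff n) x ^ 2 ≤ (1 / ((n : ℝ) + 1)) ^ 2 := by
    intro k
    have := norm_lineDeriv_le_of_lipschitz ℝ (lipschitzWith_ballCutoff (q := q) n) (x₀ := x)
      (v := Pi.single k 1)
    rw [Pi.norm_single, norm_one, mul_one] at this
    push_cast at this
    rw [← sq_abs]
    gcongr
    exact this
  have hb : ballCutoff n x ^ 2 ≤ 1 := by
    rw [← sq_abs]; exact pow_le_one₀ (abs_nonneg _) (abs_ballCutoff_le_one n x)
  have key : ∀ j k, partialDeriv k (fun y => ballCutoff n y * g y j) x ^ 2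
      ≤ 2 * partialDeriv k (fun y => g y j) x ^ 2 + 2 * (1 / ((n : ℝ) + 1)) ^ 2 * g x j ^ 2 := by
    intro j k
    have h2 := (hx j).lineDifferentiableAt (v := Pi.single k (1 : ℝ)) |>.hasLineDerivAt
    rw [partialDeriv, ((h1 k).mul_real h2).lineDeriv]
    set a := partialDeriv k (ballCutoff n) x
    set b := lineDeriv ℝ (fun y => g y j) x (Pi.single k 1)
    nlinarith [sq_nonneg (a * g x j - ballCutoff n x * b),
      mul_le_mul_of_nonneg_right (hc k) (sq_nonneg (g x j)),
      mul_le_mul_of_nonneg_right hb (sq_nonneg b)]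
  calc gradSq (fun x j => ballCutoff n x * g x j) x
      ≤ ∑ j, ∑ k, (2 * partialDeriv k (fun y => g y j) x ^ 2
          + 2 * (1 / ((n : ℝ) + 1)) ^ 2 * g x j ^ 2) :=
        Finset.sum_le_sum fun j _ => Finset.sum_le_sum fun k _ => key j k
    _ = _ := by
        simp only [Finset.sum_add_distrib, ← Finset.mul_sum, gradSq, Finset.sum_const,
          Finset.card_univ, Fintype.card_fin, nsmul_eq_mul]
        field_simp

/-- Second-order Stein inequality for locally Lipschitz vector fields. -/
lemma lintegral_gaussDiv_sq_le {q : ℕ} {g : (Fin q → ℝ) → Fin q → ℝ}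
    (hg : ∀ j, LocallyLipschitz fun x => g x j)
    (hd : ∀ j, ∀ᵐ x ∂(volume : Measure (Fin q → ℝ)), DifferentiableAt ℝ (fun y => g y j) x) :
    ∫⁻ x, ENNReal.ofReal (gaussDiv g x ^ 2) ∂gaussPi q
      ≤ ∫⁻ x, ENNReal.ofReal (∑ j, g x j ^ 2 + 2 * gradSq g x) ∂gaussPi q := by
  set G : ℕ → (Fin q → ℝ) → Fin q → ℝ := fun n x j => ballCutoff n x * g x j with hG
  have hl : ∀ n j, LocallyLipschitz fun x => G n x j := fun n j =>
    (lipschitzWith_ballCutoff n).locallyLipschitz.mul_real (hg j)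
  have hcs : ∀ n j, HasCompactSupport fun x => G n x j := fun n j =>
    (hasCompactSupport_ballCutoff n).mul_right
  have hlim : ∀ x, Tendsto (fun n => ENNReal.ofReal (gaussDiv (G n) x ^ 2)) atTop
      (𝓝 (ENNReal.ofReal (gaussDiv g x ^ 2))) := by
    intro x
    obtain ⟨N, hN⟩ := exists_nat_gt ‖x‖
    refine tendsto_const_nhds.congr' ?_
    filter_upwards [eventually_ge_atTop N] with n hn
    have hx : ‖x‖ < n + 1 := by
      have : (N : ℝ) ≤ n := by exact_mod_cast hn
      linarith
    have he : ∀ j, (fun y => G n y j) =ᶠ[𝓝 x] fun y => g y j := fun j => by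
      filter_upwards [ballCutoff_eventuallyEq_one hx] with y hy
      simp [hG, hy]
    have : gaussDiv (G n) x = gaussDiv g x := by
      refine Finset.sum_congr rfl fun j _ => ?_
      rw [partialDeriv, (he j).lineDeriv_eq, (he j).eq_of_nhds]
    rw [this]
  have hbound : ∀ n : ℕ, ∫⁻ x, ENNReal.ofReal (gaussDiv (G n) x ^ 2) ∂gaussPi q
      ≤ ENNReal.ofReal (1 + 2 * q / ((n : ℝ) + 1) ^ 2)
        * ∫⁻ x, ENNReal.ofReal (∑ j, g x j ^ 2 + 2 * gradSq g x) ∂gaussPi q := by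
    intro n
    refine (lintegral_gaussDiv_sq_le_of_hasCompactSupport
      (fun j => (hl n j).exists_lipschitzWith_of_hasCompactSupport (hcs n j)) (hcs n)).trans ?_
    rw [← lintegral_const_mul' _ _ ENNReal.ofReal_ne_top]
    refine lintegral_mono_ae ?_
    filter_upwards [(gaussPi_absolutelyContinuous q).ae_le (gradSq_ballCutoff_mul_le hd n)]
      with x hx
    rw [← ENNReal.ofReal_mul (by positivity)]
    refine ENNReal.ofReal_le_ofReal ?_
    have h1 : ∑ j, G n x j ^ 2 ≤ ∑ j, g x j ^ 2 := by
      refine Finset.sum_le_sum fun j _ => ?_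
      simp only [hG, mul_pow]
      refine mul_le_of_le_one_left (sq_nonneg _) ?_
      rw [← sq_abs]; exact pow_le_one₀ (abs_nonneg _) (abs_ballCutoff_le_one n x)
    have h2 : 0 ≤ 2 * q / ((n : ℝ) + 1) ^ 2 * (2 * gradSq g x) := by
      have := gradSq_nonneg g x
      positivity
    linarith
  have hT : Tendsto (fun n : ℕ => ENNReal.ofReal (1 + 2 * q / ((n : ℝ) + 1) ^ 2)
        * ∫⁻ x, ENNReal.ofReal (∑ j, g x j ^ 2 + 2 * gradSq g x) ∂gaussPi q) atTop
      (𝓝 (1 * ∫⁻ x, ENNReal.ofReal (∑ j, g x j ^ 2 + 2 * gradSq g x) ∂gaussPi q)) := by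
    refine ENNReal.Tendsto.mul_const ?_ (Or.inl one_ne_zero)
    rw [← ENNReal.ofReal_one]
    refine ENNReal.tendsto_ofReal ?_
    have : Tendsto (fun n : ℕ => 1 + 2 * (q : ℝ) * (1 / ((n : ℝ) + 1)) ^ 2) atTop
        (𝓝 (1 + 2 * (q : ℝ) * 0 ^ 2)) :=
      ((tendsto_one_div_add_atTop_nhds_zero_nat.pow 2).const_mul _).const_add _
    simpa [div_eq_mul_inv] using this
  calc ∫⁻ x, ENNReal.ofReal (gaussDiv g x ^ 2) ∂gaussPi q
      = ∫⁻ x, liminf (fun n => ENNReal.ofReal (gaussDiv (G n) x ^ 2)) atTop ∂gaussPi q :=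
        lintegral_congr fun x => (hlim x).liminf_eq.symm
    _ ≤ liminf (fun n => ∫⁻ x, ENNReal.ofReal (gaussDiv (G n) x ^ 2) ∂gaussPi q) atTop :=
        lintegral_liminf_le fun n => ((measurable_gaussDiv (hl n)).pow_const 2).ennreal_ofReal
    _ ≤ _ := (liminf_le_liminf (Eventually.of_forall hbound)).trans
        (by rw [hT.liminf_eq, one_mul])

lemma ofReal_sq_integral_le {α : Type*} [MeasurableSpace α] {μ : Measure α} {u : α → ℝ}
    (hu : AEStronglyMeasurable u μ) :
    ENNReal.ofReal ((∫ x, u x ∂μ) ^ 2) ≤ μ Set.univ * ∫⁻ x, ENNReal.ofReal (u x ^ 2) ∂μ := by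
  have h1 := ENNReal.lintegral_mul_le_Lp_mul_Lq μ Real.HolderConjugate.two_two
    (f := fun x => ‖u x‖ₑ) (g := fun _ => 1) hu.enorm aemeasurable_const
  have hsq : ∀ a : ℝ, ENNReal.ofReal (a ^ 2) = ‖a‖ₑ ^ (2 : ℝ) := fun a => by
    rw [← sq_abs, ENNReal.ofReal_pow (abs_nonneg a), ENNReal.rpow_two,
      Real.enorm_eq_ofReal_abs]
  simp only [Pi.mul_apply, mul_one, ENNReal.one_rpow, lintegral_const, one_mul] at h1
  simp only [hsq]
  calc ‖∫ x, u x ∂μ‖ₑ ^ (2 : ℝ)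
      ≤ ((∫⁻ x, ‖u x‖ₑ ^ (2 : ℝ) ∂μ) ^ (1 / 2 : ℝ) * μ Set.univ ^ (1 / 2 : ℝ)) ^ (2 : ℝ) := by
        gcongr
        exact (enorm_integral_le_lintegral_enorm u).trans h1
    _ = _ := by
        rw [ENNReal.mul_rpow_of_nonneg _ _ two_pos.le, ← ENNReal.rpow_mul, ← ENNReal.rpow_mul]
        simp [mul_comm]

/-- The derivative along the rotation flow. -/
def rotationDeriv {q : ℕ} (φ : (Fin q → ℝ) → ℝ) (p : (Fin q → ℝ) × (Fin q → ℝ)) : ℝ :=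
  (fun k => partialDeriv k φ p.1) ⬝ᵥ p.2

lemma continuous_pairRotation {q : ℕ} :
    Continuous fun s : ((Fin q → ℝ) × (Fin q → ℝ)) × ℝ => pairRotation s.2 s.1 := by
  unfold pairRotation; fun_prop

lemma measurable_rotationDeriv {q : ℕ} {φ : (Fin q → ℝ) → ℝ} (hφ : Continuous φ) :
    Measurable (rotationDeriv φ) := by
  unfold rotationDeriv dotProduct
  refine Finset.measurable_fun_sum _ fun k _ => Measurable.mul ?_ ?_
  · exact (measurable_lineDeriv hφ).comp measurable_fst
  · exact (measurable_pi_apply k).comp measurable_snd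

lemma hasDerivAt_comp_pairRotation {q : ℕ} {φ : (Fin q → ℝ) → ℝ}
    {p : (Fin q → ℝ) × (Fin q → ℝ)} {θ : ℝ} (h : DifferentiableAt ℝ φ (pairRotation θ p).1) :
    HasDerivAt (fun θ => φ (pairRotation θ p).1) (rotationDeriv φ (pairRotation θ p)) θ := by
  have hp : HasDerivAt (fun θ => (pairRotation θ p).1) (pairRotation θ p).2 θ :=
    ((Real.hasDerivAt_cos θ).smul_const p.1).add ((Real.hasDerivAt_sin θ).smul_const p.2)
  refine (h.hasFDerivAt.comp_hasDerivAt θ hp).congr_deriv ?_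
  have := LinearMap.pi_apply_eq_sum_univ (fderiv ℝ φ (pairRotation θ p).1).toLinearMap
    (pairRotation θ p).2
  refine this.trans (Finset.sum_congr rfl fun k _ => ?_)
  change _ = lineDeriv ℝ φ (pairRotation θ p).1 (Pi.single k 1) * (pairRotation θ p).2 k
  rw [h.lineDeriv_eq_fderiv, smul_eq_mul, mul_comm]
  have hk : (fun j => if k = j then (1 : ℝ) else 0) = Pi.single k 1 := by
    ext j; simp [Pi.single_apply, eq_comm]
  rw [hk]
  rfl

lemma ofReal_sub_sq_le_lintegral_rotationDeriv {q : ℕ} {φ : (Fin q → ℝ) → ℝ}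
    (hφ : LocallyLipschitz φ) {p : (Fin q → ℝ) × (Fin q → ℝ)}
    (hp : ∀ᵐ θ ∂(volume.restrict (Set.Ioc 0 (Real.pi / 2))),
      DifferentiableAt ℝ φ (pairRotation θ p).1) :
    ENNReal.ofReal ((φ p.2 - φ p.1) ^ 2) ≤ ENNReal.ofReal (Real.pi / 2)
      * ∫⁻ θ in Set.Ioc (0 : ℝ) (Real.pi / 2), ENNReal.ofReal (rotationDeriv φ (pairRotation θ p) ^ 2) := by
  have hpi : 0 ≤ Real.pi / 2 := by positivity
  set w : ℝ → ℝ := fun θ => φ (pairRotation θ p).1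
  have hw : LocallyLipschitz w := hφ.comp (ContDiff.locallyLipschitz (by
    unfold pairRotation; fun_prop : ContDiff ℝ 1 fun θ => (pairRotation θ p).1))
  obtain ⟨K, hK⟩ := (hw.locallyLipschitzOn
    (s := Set.uIcc 0 (Real.pi / 2))).exists_lipschitzOnWith_of_compact isCompact_uIcc
  have hac := hK.absolutelyContinuousOnInterval
  have hI := hac.integral_deriv_eq_sub
  rw [intervalIntegral.integral_of_le hpi] at hI
  have h0 : w 0 = φ p.1 := by simp [w, pairRotation]
  have h1 : w (Real.pi / 2) = φ p.2 := by simp [w, pairRotation]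
  rw [← h0, ← h1, ← hI]
  refine (ofReal_sq_integral_le (measurable_deriv w).aestronglyMeasurable).trans ?_
  rw [Measure.restrict_apply_univ, Real.volume_Ioc, sub_zero]
  gcongr ENNReal.ofReal _ * ?_
  refine (lintegral_congr_ae ?_).le
  filter_upwards [hp] with θ hθ
  rw [(hasDerivAt_comp_pairRotation hθ).deriv]

/-- Pisier's form of the Gaussian Poincaré inequality. -/
lemma lintegral_sub_sq_gaussPi_le {q : ℕ} {φ : (Fin q → ℝ) → ℝ} (hφ : LocallyLipschitz φ)
    (hd : ∀ᵐ x ∂(volume : Measure (Fin q → ℝ)), DifferentiableAt ℝ φ x) :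
    ∫⁻ x, ∫⁻ y, ENNReal.ofReal ((φ y - φ x) ^ 2) ∂gaussPi q ∂gaussPi q
      ≤ ENNReal.ofReal (Real.pi ^ 2 / 4)
        * ∫⁻ x, ENNReal.ofReal (∑ k, partialDeriv k φ x ^ 2) ∂gaussPi q := by
  have hc := hφ.continuous
  have hrot : ∀ θ : ℝ, Measurable (pairRotation (q := q) θ) := fun θ =>
    (by unfold pairRotation; fun_prop : Continuous (pairRotation (q := q) θ)).measurable
  have hmp : ∀ θ, MeasurePreserving (pairRotation (q := q) θ) ((gaussPi q).prod (gaussPi q))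
      ((gaussPi q).prod (gaussPi q)) := fun θ => ⟨hrot θ, map_pairRotation_gaussPi θ⟩
  have hae : ∀ᵐ p ∂(gaussPi q).prod (gaussPi q), ∀ᵐ θ ∂volume.restrict (Set.Ioc 0 (Real.pi / 2)),
      DifferentiableAt ℝ φ (pairRotation θ p).1 := by
    have hms : MeasurableSet {s : ((Fin q → ℝ) × (Fin q → ℝ)) × ℝ |
        DifferentiableAt ℝ φ (pairRotation s.2 s.1).1} :=
      (measurable_fst.comp continuous_pairRotation.measurable)
        (measurableSet_of_differentiableAt ℝ φ)
    refine (Measure.ae_ae_comm hms).2 (ae_of_all _ fun θ => ?_)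
    exact (measurePreserving_fst.comp (hmp θ)).quasiMeasurePreserving.ae
      ((gaussPi_absolutelyContinuous q).ae_le hd)
  have hG : Measurable fun p => ENNReal.ofReal (rotationDeriv φ p ^ 2) :=
    ((measurable_rotationDeriv hc).pow_const 2).ennreal_ofReal
  calc ∫⁻ x, ∫⁻ y, ENNReal.ofReal ((φ y - φ x) ^ 2) ∂gaussPi q ∂gaussPi q
      = ∫⁻ p, ENNReal.ofReal ((φ p.2 - φ p.1) ^ 2) ∂(gaussPi q).prod (gaussPi q) := by
        rw [lintegral_prod _ (by fun_prop)]
    _ ≤ ∫⁻ p, (ENNReal.ofReal (Real.pi / 2) * ∫⁻ θ in Set.Ioc (0 : ℝ) (Real.pi / 2),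
          ENNReal.ofReal (rotationDeriv φ (pairRotation θ p) ^ 2))
          ∂(gaussPi q).prod (gaussPi q) := by
        refine lintegral_mono_ae ?_
        filter_upwards [hae] with p hp using ofReal_sub_sq_le_lintegral_rotationDeriv hφ hp
    _ = ENNReal.ofReal (Real.pi / 2) * ∫⁻ θ in Set.Ioc (0 : ℝ) (Real.pi / 2), ∫⁻ p,
          ENNReal.ofReal (rotationDeriv φ p ^ 2) ∂(gaussPi q).prod (gaussPi q) := by
        have hm : Measurable (Function.uncurry fun (p : (Fin q → ℝ) × (Fin q → ℝ)) (θ : ℝ) =>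
            ENNReal.ofReal (rotationDeriv φ (pairRotation θ p) ^ 2)) :=
          hG.comp continuous_pairRotation.measurable
        rw [lintegral_const_mul' _ _ ENNReal.ofReal_ne_top,
          lintegral_lintegral_swap hm.aemeasurable]
        simp_rw [fun θ => (hmp θ).lintegral_comp hG]
    _ = _ := by
        rw [lintegral_prod _ hG.aemeasurable]
        simp_rw [rotationDeriv, lintegral_dotProduct_sq_gaussPi]
        rw [lintegral_const, Measure.restrict_apply_univ, Real.volume_Ioc, sub_zero, mul_comm
          (lintegral _ _), ← mul_assoc, ← ENNReal.ofReal_mul (by positivity)]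
        ring_nf

lemma vnorm_sq {k : ℕ} (v : Fin k → ℝ) : vnorm v ^ 2 = ∑ i, v i ^ 2 :=
  Real.sq_sqrt (by positivity)

lemma sum_sq_pos {k : ℕ} {v : Fin k → ℝ} (hv : v ≠ 0) : 0 < ∑ i, v i ^ 2 := by
  obtain ⟨i, hi⟩ := Function.ne_iff.1 hv
  exact Finset.sum_pos' (fun _ _ => sq_nonneg _) ⟨i, Finset.mem_univ i, by
    have : v i ≠ 0 := hi
    positivity⟩

lemma vnorm_pos {k : ℕ} {v : Fin k → ℝ} (hv : v ≠ 0) : 0 < vnorm v :=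
  Real.sqrt_pos.2 (sum_sq_pos hv)

/-- The unit vector in the direction of `v`. -/
def unitVec {k : ℕ} (v : Fin k → ℝ) (l : Fin k) : ℝ := v l / vnorm v

lemma sum_unitVec_sq {k : ℕ} {v : Fin k → ℝ} (hv : v ≠ 0) : ∑ l, unitVec v l ^ 2 = 1 := by
  simp only [unitVec, div_pow, ← Finset.sum_div, ← vnorm_sq]
  exact div_self (pow_pos (vnorm_pos hv) 2).ne'

lemma contDiffAt_unitVec {k : ℕ} {v : Fin k → ℝ} (hv : v ≠ 0) (l : Fin k) :
    ContDiffAt ℝ 1 (fun v => unitVec v l) v := by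
  have h : ContDiffAt ℝ 1 (fun v : Fin k → ℝ => ∑ i, v i ^ 2) v := by fun_prop
  exact ContDiffAt.div (by fun_prop) (h.sqrt (sum_sq_pos hv).ne') (vnorm_pos hv).ne'

lemma LocallyLipschitz.contDiffAt_comp {E F G : Type*} [NormedAddCommGroup E] [NormedSpace ℝ E]
    [NormedAddCommGroup F] [NormedSpace ℝ F] [PseudoEMetricSpace G] {f : G → E} {Φ : E → F}
    (hf : LocallyLipschitz f) (hΦ : ∀ x, ContDiffAt ℝ 1 Φ (f x)) :
    LocallyLipschitz fun x => Φ (f x) := by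
  intro x
  obtain ⟨K, t, ht, hK⟩ := hf x
  obtain ⟨L, s, hs, hL⟩ := (hΦ x).exists_lipschitzOnWith
  refine ⟨L * K, t ∩ f ⁻¹' s, inter_mem ht (hf.continuous.continuousAt.preimage_mem_nhds hs), ?_⟩
  exact hL.comp (hK.mono Set.inter_subset_left) fun y hy => hy.2

section Normalization

variable {q : ℕ} {f : (Fin q → ℝ) → Fin q → ℝ} {A : Matrix (Fin q) (Fin q) ℝ} {x : Fin q → ℝ}

lemma partialDeriv_unitVec_sub (hne : f x ≠ 0)
    (hf : HasFDerivAt f A.mulVecLin.toContinuousLinearMap x) (u : Fin q → ℝ) (l k : Fin q) :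
    partialDeriv k (fun y => unitVec (f y) l - u l) x
      = A l k / vnorm (f x) - f x l * (∑ i, f x i * A i k) / vnorm (f x) ^ 3 := by
  have hc : ∀ i, HasDerivAt (fun t : ℝ => f (x + t • Pi.single k 1) i) (A i k) 0 := by
    have := hasDerivAt_pi.1 (hf.hasLineDerivAt (Pi.single k 1))
    intro i
    simpa [mulVec_single] using this i
  have hs := HasDerivAt.fun_sum fun i (_ : i ∈ Finset.univ) => (hc i).fun_pow 2
  have hr := vnorm_pos hne
  have h0 : x + (0 : ℝ) • Pi.single k 1 = x := by simp
  have hd := ((hc l).fun_div (hs.sqrt (by rw [h0]; exact (sum_sq_pos hne).ne'))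
    (by rw [h0]; exact hr.ne')).sub_const (u l)
  refine HasLineDerivAt.lineDeriv (HasDerivAt.congr_deriv hd ?_)
  simp only [h0]
  change (A l k * vnorm (f x) - f x l * (_ / (2 * vnorm (f x)))) / vnorm (f x) ^ 2 = _
  have : ∑ i, (2 : ℕ) * f x i ^ (2 - 1) * A i k = 2 * ∑ i, f x i * A i k := by
    rw [Finset.mul_sum]
    refine Finset.sum_congr rfl fun i _ => ?_
    push_cast; ring
  rw [this]
  field_simp

lemma gradSq_unitVec_sub_le (hne : f x ≠ 0)
    (hf : HasFDerivAt f A.mulVecLin.toContinuousLinearMap x) (u : Fin q → ℝ) :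
    gradSq (fun y l => unitVec (f y) l - u l) x
      ≤ (∑ k, vnorm (fun l => A l k) ^ 2) / vnorm (f x) ^ 2 := by
  have hr := vnorm_pos hne
  rw [gradSq, Finset.sum_comm, Finset.sum_div]
  refine Finset.sum_le_sum fun k _ => ?_
  set s := ∑ i, f x i * A i k with hs
  calc ∑ l, partialDeriv k (fun y => unitVec (f y) l - u l) x ^ 2
      = ∑ l, (A l k ^ 2 / vnorm (f x) ^ 2 - 2 * s / vnorm (f x) ^ 4 * (f x l * A l k)
          + s ^ 2 / vnorm (f x) ^ 6 * f x l ^ 2) := by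
        refine Finset.sum_congr rfl fun l _ => ?_
        rw [partialDeriv_unitVec_sub hne hf]
        field_simp
        ring
    _ = vnorm (fun l => A l k) ^ 2 / vnorm (f x) ^ 2 - s ^ 2 / vnorm (f x) ^ 4 := by
        rw [Finset.sum_add_distrib, Finset.sum_sub_distrib, ← Finset.sum_div, ← Finset.mul_sum,
          ← Finset.mul_sum, ← hs, ← vnorm_sq, ← vnorm_sq]
        field_simp
        ring
    _ ≤ _ := sub_le_self _ (by positivity)

lemma stein_sub_sq_le (hne : f x ≠ 0)
    (hf : HasFDerivAt f A.mulVecLin.toContinuousLinearMap x) (u : Fin q → ℝ) :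
    ((f x ⬝ᵥ x - A.trace) / vnorm (f x) - u ⬝ᵥ x) ^ 2
      ≤ 3 / 2 * gaussDiv (fun y l => unitVec (f y) l - u l) x ^ 2
        + 3 * ((∑ k, vnorm (fun l => A l k) ^ 2) / vnorm (f x) ^ 2) := by
  have hr := vnorm_pos hne
  set Q := ∑ j, f x j * (∑ i, f x i * A i j) with hQ
  have hδ : gaussDiv (fun y l => unitVec (f y) l - u l) x
      = (f x ⬝ᵥ x - A.trace) / vnorm (f x) - u ⬝ᵥ x + Q / vnorm (f x) ^ 3 := by
    simp only [gaussDiv, partialDeriv_unitVec_sub hne hf, dotProduct, Matrix.trace, diag, hQ,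
      Finset.sum_div, sub_div, ← Finset.sum_sub_distrib, ← Finset.sum_add_distrib]
    refine Finset.sum_congr rfl fun j _ => ?_
    rw [unitVec]
    ring
  have hQ2 : Q ^ 2 ≤ vnorm (f x) ^ 4 * ∑ k, vnorm (fun l => A l k) ^ 2 := by
    have h1 := Finset.sum_mul_sq_le_sq_mul_sq Finset.univ (f x) fun j => ∑ i, f x i * A i j
    have h2 : ∑ j, (∑ i, f x i * A i j) ^ 2
        ≤ ∑ j, vnorm (f x) ^ 2 * vnorm (fun l => A l j) ^ 2 := by
      refine Finset.sum_le_sum fun j _ => ?_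
      rw [vnorm_sq, vnorm_sq]
      exact Finset.sum_mul_sq_le_sq_mul_sq _ _ _
    rw [← Finset.mul_sum] at h2
    rw [← vnorm_sq] at h1
    nlinarith [mul_le_mul_of_nonneg_left h2 (sq_nonneg (vnorm (f x)))]
  have hQ3 : (Q / vnorm (f x) ^ 3) ^ 2
      ≤ (∑ k, vnorm (fun l => A l k) ^ 2) / vnorm (f x) ^ 2 := by
    rw [div_pow, div_le_div_iff₀ (by positivity) (by positivity)]
    nlinarith [mul_le_mul_of_nonneg_right hQ2 (sq_nonneg (vnorm (f x)))]
  rw [hδ]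
  nlinarith [sq_nonneg ((f x ⬝ᵥ x - A.trace) / vnorm (f x) - u ⬝ᵥ x + 3 * (Q / vnorm (f x) ^ 3))]

end Normalization


/-- A vector-valued form of Pisier's inequality, evaluated at a well-chosen base point. -/
lemma exists_lintegral_sub_sq_le {q : ℕ} {h : (Fin q → ℝ) → Fin q → ℝ}
    (hl : ∀ j, LocallyLipschitz fun x => h x j)
    (hd : ∀ j, ∀ᵐ x ∂(volume : Measure (Fin q → ℝ)), DifferentiableAt ℝ (fun y => h y j) x) :
    ∃ x, ∫⁻ y, ENNReal.ofReal (∑ j, (h y j - h x j) ^ 2) ∂gaussPi q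
      ≤ ENNReal.ofReal (Real.pi ^ 2 / 4) * ∫⁻ x, ENNReal.ofReal (gradSq h x) ∂gaussPi q := by
  have hc : ∀ j, Measurable fun x => h x j := fun j => (hl j).continuous.measurable
  have hm : ∀ j, Measurable (Function.uncurry fun x y =>
      ENNReal.ofReal ((h y j - h x j) ^ 2)) := fun j =>
    ((((hc j).comp measurable_snd).sub ((hc j).comp measurable_fst)).pow_const 2).ennreal_ofReal
  have hsum : ∀ x, ∫⁻ y, ENNReal.ofReal (∑ j, (h y j - h x j) ^ 2) ∂gaussPi q
      = ∑ j, ∫⁻ y, ENNReal.ofReal ((h y j - h x j) ^ 2) ∂gaussPi q := by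
    intro x
    simp_rw [fun y => ENNReal.ofReal_sum_of_nonneg (s := Finset.univ)
      fun j _ => sq_nonneg (h y j - h x j)]
    exact lintegral_finsetSum _ fun j _ => (hm j).of_uncurry_left
  have hm' : ∀ j, Measurable fun x => ∫⁻ y, ENNReal.ofReal ((h y j - h x j) ^ 2) ∂gaussPi q :=
    fun j => (hm j).lintegral_prod_right
  obtain ⟨x, hx⟩ := exists_le_lintegral (μ := gaussPi q)
    (f := fun x => ∫⁻ y, ENNReal.ofReal (∑ j, (h y j - h x j) ^ 2) ∂gaussPi q) (by
      simp_rw [hsum]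
      exact (Finset.measurable_fun_sum _ fun j _ => hm' j).aemeasurable)
  refine ⟨x, hx.trans ?_⟩
  simp_rw [hsum]
  rw [lintegral_finsetSum _ fun j _ => hm' j]
  refine (Finset.sum_le_sum fun j _ => lintegral_sub_sq_gaussPi_le (hl j) (hd j)).trans ?_
  rw [← Finset.mul_sum, ← lintegral_finsetSum _ fun j _ => Measurable.ennreal_ofReal
    (Finset.measurable_fun_sum _ fun k _ =>
      (measurable_lineDeriv (hl j).continuous).pow_const 2)]
  refine le_of_eq ?_
  congr 2; ext y
  rw [← ENNReal.ofReal_sum_of_nonneg fun j _ => Finset.sum_nonneg fun k _ => sq_nonneg _]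
  rfl

/-- **Proposition 7.1 (variant of the second-order normal approximation).**
Let `z ∼ N(0, I_q)` and `f : ℝ^q → ℝ^q \ {0}` be locally Lipschitz with
`E[‖f(z)‖⁻² ∑_k ‖(∂/∂z_k) f(z)‖²] < ∞` (the Jacobian `J` exists a.e. by Rademacher).
Then there exists `Z ∼ N(0,1)` with
`E[((fᵀz - ∑_k ∂f_k/∂z_k)/‖f‖ - Z)²] ≤ (7 + 2√6) E[‖f‖⁻² ∑_k ‖∂f/∂z_k‖²]`. -/
theorem normal_approximation_variant
    (q : ℕ) (Ω : Type) [MeasurableSpace Ω] (P : Measure Ω) [IsProbabilityMeasure P]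
    (z : Ω → Fin q → ℝ) (hz : Measurable z)
    (hzlaw : P.map z = Measure.pi fun _ : Fin q => gaussianReal 0 1)
    (f : (Fin q → ℝ) → Fin q → ℝ) (hlip : LocallyLipschitz f) (hne : ∀ x, f x ≠ 0)
    (J : (Fin q → ℝ) → Matrix (Fin q) (Fin q) ℝ)
    (hJ : ∀ᵐ x ∂(volume : Measure (Fin q → ℝ)),
      HasFDerivAt f (J x).mulVecLin.toContinuousLinearMap x)
    (hmom : Integrable
      (fun ω => (∑ k, vnorm (fun l => J (z ω) l k) ^ 2) / vnorm (f (z ω)) ^ 2) P) :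
    ∃ Z : Ω → ℝ, Measurable Z ∧ P.map Z = gaussianReal 0 1 ∧
      ∫ ω, ((f (z ω) ⬝ᵥ z ω - (J (z ω)).trace) / vnorm (f (z ω)) - Z ω) ^ 2 ∂P
        ≤ (7 + 2 * Real.sqrt 6) *
            ∫ ω, (∑ k, vnorm (fun l => J (z ω) l k) ^ 2) / vnorm (f (z ω)) ^ 2 ∂P := by
  set m : (Fin q → ℝ) → ℝ := fun x => (∑ k, vnorm (fun l => J x l k) ^ 2) / vnorm (f x) ^ 2
  have hm0 : ∀ x, 0 ≤ m x := fun x => by positivity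
  set M := ∫⁻ ω, ENNReal.ofReal (m (z ω)) ∂P
  have hl : ∀ (u : Fin q → ℝ) j, LocallyLipschitz fun x => unitVec (f x) j - u j := fun u j =>
    hlip.contDiffAt_comp (Φ := fun v => unitVec v j - u j) fun x =>
      (contDiffAt_unitVec (hne x) j).sub contDiffAt_const
  have hd : ∀ (u : Fin q → ℝ) j, ∀ᵐ x ∂(volume : Measure (Fin q → ℝ)),
      DifferentiableAt ℝ (fun y => unitVec (f y) j - u j) x := fun u j => by
    filter_upwards [hJ] with x hx
    exact (((contDiffAt_unitVec (hne x) j).differentiableAt one_ne_zero).comp x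
      hx.differentiableAt).sub_const (u j)
  have hgrad : ∀ u : Fin q → ℝ,
      ∫⁻ x, ENNReal.ofReal (gradSq (fun y l => unitVec (f y) l - u l) x) ∂gaussPi q ≤ M := by
    intro u
    refine (lintegral_mono_ae (g := fun x => ENNReal.ofReal (m x)) ?_).trans ?_
    · filter_upwards [(gaussPi_absolutelyContinuous q).ae_le hJ] with x hx
      exact ENNReal.ofReal_le_ofReal (gradSq_unitVec_sub_le (hne x) hx u)
    · rw [gaussPi, ← hzlaw]
      exact lintegral_map_le _ _
  have hpi : Real.pi ^ 2 / 4 ≤ 5 / 2 := by nlinarith [Real.pi_lt_d2, Real.pi_pos]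
  obtain ⟨x₀, hx₀⟩ := exists_lintegral_sub_sq_le (h := fun x l => unitVec (f x) l - (0 : Fin q → ℝ) l)
    (hl 0) (hd 0)
  set u := unitVec (f x₀)
  set g : (Fin q → ℝ) → Fin q → ℝ := fun y l => unitVec (f y) l - u l with hg
  have hG : ∫⁻ y, ENNReal.ofReal (∑ j, g y j ^ 2) ∂gaussPi q ≤ ENNReal.ofReal (5 / 2) * M := by
    refine Eq.trans_le ?_ (hx₀.trans (mul_le_mul' (ENNReal.ofReal_le_ofReal hpi) (hgrad 0)))
    simp [hg, u]
  have hδ : ∫⁻ x, ENNReal.ofReal (gaussDiv g x ^ 2) ∂gaussPi q ≤ ENNReal.ofReal (9 / 2) * M := by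
    refine (lintegral_gaussDiv_sq_le (g := g) (hl u) (hd u)).trans ?_
    have hadd : ∀ x, ENNReal.ofReal (∑ j, g x j ^ 2 + 2 * gradSq g x)
        = ENNReal.ofReal (∑ j, g x j ^ 2) + ENNReal.ofReal 2 * ENNReal.ofReal (gradSq g x) := by
      intro x
      rw [ENNReal.ofReal_add (by positivity) (mul_nonneg two_pos.le (gradSq_nonneg g x)),
        ENNReal.ofReal_mul two_pos.le]
    have hgm : ∀ j, Measurable fun x => g x j := fun j => (hl u j).continuous.measurable
    rw [lintegral_congr hadd]
    rw [lintegral_add_left (by fun_prop), lintegral_const_mul' _ _ ENNReal.ofReal_ne_top,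
      show (9 / 2 : ℝ) = 5 / 2 + 2 by norm_num, ENNReal.ofReal_add (by norm_num) two_pos.le, add_mul]
    gcongr
    exact hgrad u
  refine ⟨fun ω => u ⬝ᵥ z ω, ?_, ?_, ?_⟩
  · unfold dotProduct; fun_prop
  · have hmu : Measurable fun x : Fin q → ℝ => u ⬝ᵥ x := by unfold dotProduct; fun_prop
    rw [← Function.comp_def (fun x => u ⬝ᵥ x) z, ← Measure.map_map hmu hz, hzlaw,
      map_gaussPi_dotProduct, sum_unitVec_sq (hne x₀), Real.toNNReal_one]
  set T : Ω → ℝ := fun ω => ((f (z ω) ⬝ᵥ z ω - (J (z ω)).trace) / vnorm (f (z ω)) - u ⬝ᵥ z ω) ^ 2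
  have hδm : Measurable fun x => ENNReal.ofReal (gaussDiv g x ^ 2) :=
    ((measurable_gaussDiv (hl u)).pow_const 2).ennreal_ofReal
  have hT : ∫⁻ ω, ENNReal.ofReal (T ω) ∂P ≤ ENNReal.ofReal (39 / 4) * M := by
    have hJz : ∀ᵐ ω ∂P, HasFDerivAt f (J (z ω)).mulVecLin.toContinuousLinearMap (z ω) := by
      refine ae_of_ae_map (p := fun x => HasFDerivAt f (J x).mulVecLin.toContinuousLinearMap x)
        hz.aemeasurable ?_
      rw [hzlaw]
      exact (gaussPi_absolutelyContinuous q).ae_le hJ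
    calc ∫⁻ ω, ENNReal.ofReal (T ω) ∂P
        ≤ ∫⁻ ω, (ENNReal.ofReal (3 / 2) * ENNReal.ofReal (gaussDiv g (z ω) ^ 2)
            + ENNReal.ofReal 3 * ENNReal.ofReal (m (z ω))) ∂P := by
          refine lintegral_mono_ae ?_
          filter_upwards [hJz] with ω hω
          rw [← ENNReal.ofReal_mul (by norm_num), ← ENNReal.ofReal_mul (by norm_num),
            ← ENNReal.ofReal_add (by positivity) (mul_nonneg (by norm_num) (hm0 _))]
          exact ENNReal.ofReal_le_ofReal (stein_sub_sq_le (hne _) hω u)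
      _ = ENNReal.ofReal (3 / 2) * ∫⁻ x, ENNReal.ofReal (gaussDiv g x ^ 2) ∂gaussPi q
            + ENNReal.ofReal 3 * M := by
          have hδz : Measurable fun ω => ENNReal.ofReal (gaussDiv g (z ω) ^ 2) := hδm.comp hz
          rw [lintegral_add_left (hδz.const_mul _),
            lintegral_const_mul' _ _ ENNReal.ofReal_ne_top,
            lintegral_const_mul' _ _ ENNReal.ofReal_ne_top, gaussPi, ← hzlaw,
            lintegral_map hδm hz]
      _ ≤ ENNReal.ofReal (3 / 2) * (ENNReal.ofReal (9 / 2) * M) + ENNReal.ofReal 3 * M := by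
          gcongr
      _ = _ := by
          rw [← mul_assoc, ← add_mul, ← ENNReal.ofReal_mul (by norm_num),
            ← ENNReal.ofReal_add (by norm_num) (by norm_num)]
          norm_num
  have hI0 : 0 ≤ ∫ ω, m (z ω) ∂P := integral_nonneg fun ω => hm0 _
  have h6 : (39 / 4 : ℝ) ≤ 7 + 2 * Real.sqrt 6 := by
    have : (2 : ℝ) ≤ Real.sqrt 6 := Real.le_sqrt_of_sq_le (by norm_num)
    linarith
  refine le_trans ?_ (mul_le_mul_of_nonneg_right h6 hI0)
  by_cases hTi : Integrable T P
  · rw [← ENNReal.ofReal_le_ofReal_iff (by positivity), ENNReal.ofReal_mul (by norm_num),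
      ofReal_integral_eq_lintegral_ofReal hTi (ae_of_all _ fun _ => sq_nonneg _),
      ofReal_integral_eq_lintegral_ofReal hmom (ae_of_all _ fun _ => hm0 _)]
    exact hT
  · rw [integral_undef hTi]
    positivity

end
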